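/- arXiv:2003.10034 — 2 statements merged into one kernel-verified Lean document; each statement's English description precedes it below -/
import Mathlib

section
/- Let T be the infinite rooted k-ary tree with k ≥ 2, s > 1, s' = s/(s−1), w a weight, r ≥ 1 an integer, and λ > 0. Then w({x : A_r°f(x) ≥ λ}) ≤ c_s Σ_{n≥0, 1≤2^n≤2k^r} (2^n/k^r)^{1/(2s')} 2^n M_s°w({|f| ≥ 2^{n−1}λ}), where A_r°f(x) = (1/|S(x,r)|) Σ_{y∈S(x,r)} |f(y)|, M_s°w = (M°(w^s))^{1/s}, and c_s depends only on s. -/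
open scoped ENNReal NNReal BigOperators

noncomputable section

/-- Vertices of the infinite rooted `k`-ary tree: finite words over `Fin k`. -/
abbrev V (k : ℕ) := List (Fin k)

/-- Length of the longest common prefix (depth of the deepest common ancestor). -/
def lcpLen {k : ℕ} : List (Fin k) → List (Fin k) → ℕ
  | a :: as, b :: bs => if a = b then lcpLen as bs + 1 else 0
  | _, _ => 0

/-- Graph distance on the infinite rooted `k`-ary tree. -/
def tdist {k : ℕ} (x y : V k) : ℕ :=
  (x.length - lcpLen x y) + (y.length - lcpLen x y)

/-- Sphere of radius `r` centered at `x`. -/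
def sph {k : ℕ} (x : V k) (r : ℕ) : Set (V k) := {y | tdist x y = r}

/-- Closed ball of radius `r` centered at `x`. -/
def ball {k : ℕ} (x : V k) (r : ℕ) : Set (V k) := {y | tdist x y ≤ r}

def sphCard {k : ℕ} (x : V k) (r : ℕ) : ℝ≥0∞ := ((sph x r).ncard : ℝ≥0∞)
def ballCard {k : ℕ} (x : V k) (r : ℕ) : ℝ≥0∞ := ((ball x r).ncard : ℝ≥0∞)

/-- `w(A) = Σ_{y ∈ A} w(y)`, the weighted (counting) measure of `A`. -/
def wsum {k : ℕ} (w : V k → ℝ≥0∞) (A : Set (V k)) : ℝ≥0∞ := ∑' y : A, w ↑y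

/-- Spherical average `A_r° f (x)`. -/
def sphAvg {k : ℕ} (f : V k → ℝ≥0∞) (x : V k) (r : ℕ) : ℝ≥0∞ :=
  wsum f (sph x r) / sphCard x r

/-- Spherical maximal operator `M°`. -/
def Msph {k : ℕ} (f : V k → ℝ≥0∞) (x : V k) : ℝ≥0∞ := ⨆ r : ℕ, sphAvg f x r

/-- Centered Hardy–Littlewood maximal operator `M`. -/
def Mball {k : ℕ} (f : V k → ℝ≥0∞) (x : V k) : ℝ≥0∞ :=
  ⨆ r : ℕ, wsum f (ball x r) / ballCard x r

/-- `|f|` of a real-valued function, as an `ℝ≥0∞`-valued function. -/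
def absE {k : ℕ} (f : V k → ℝ) : V k → ℝ≥0∞ := fun y => ENNReal.ofReal |f y|

/-- `M_s w = (M(w^s))^{1/s}` (centered version). -/
def MsBall {k : ℕ} (s : ℝ) (w : V k → ℝ≥0∞) (x : V k) : ℝ≥0∞ :=
  (Mball (fun y => w y ^ s) x) ^ (1 / s)

/-- `M_s° w = (M°(w^s))^{1/s}` (spherical version). -/
def MsSph {k : ℕ} (s : ℝ) (w : V k → ℝ≥0∞) (x : V k) : ℝ≥0∞ :=
  (Msph (fun y => w y ^ s) x) ^ (1 / s)

lemma lcp_comm {k : ℕ} : ∀ x y : V k, lcpLen x y = lcpLen y x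
  | [], [] => rfl
  | [], _ :: _ => rfl
  | _ :: _, [] => rfl
  | a :: as, b :: bs => by
    by_cases h : a = b
    · subst h; simp [lcpLen, lcp_comm as bs]
    · simp [lcpLen, h, Ne.symm h]

lemma lcp_take {k : ℕ} : ∀ x y : V k, x.take (lcpLen x y) = y.take (lcpLen x y)
  | [], [] => rfl
  | [], _ :: _ => rfl
  | _ :: _, [] => rfl
  | a :: as, b :: bs => by
    by_cases h : a = b
    · subst h; simp [lcpLen, lcp_take as bs]
    · simp [lcpLen, h]

lemma lcp_le {k : ℕ} : ∀ x y : V k, lcpLen x y ≤ x.length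
  | [], [] => by simp [lcpLen]
  | [], _ :: _ => by simp [lcpLen]
  | _ :: _, [] => by simp [lcpLen]
  | a :: as, b :: bs => by
    by_cases h : a = b
    · subst h; simp [lcpLen, lcp_le as bs]
    · simp [lcpLen, h]

lemma lcp_append {k : ℕ} : ∀ x v : V k, lcpLen x (x ++ v) = x.length
  | [], [] => by simp [lcpLen]
  | [], _ :: _ => by simp [lcpLen]
  | a :: as, v => by simp [lcpLen, lcp_append as v]

/-- number of upward steps from `x` to `y` -/
def up {k : ℕ} (x y : V k) : ℕ := x.length - lcpLen x y

lemma tdist_eq {k : ℕ} (x y : V k) : tdist x y = up x y + up y x := by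
  simp [tdist, up, lcp_comm y x]

lemma tdist_comm' {k : ℕ} (x y : V k) : tdist x y = tdist y x := by
  rw [tdist_eq, tdist_eq, add_comm]

def TT {k : ℕ} (x : V k) (m q : ℕ) : Finset (V k) :=
  Finset.univ.image (fun v : Fin q → Fin k => x.take (x.length - m) ++ List.ofFn v)

lemma TT_card {k : ℕ} (x : V k) (m q : ℕ) : (TT x m q).card ≤ k ^ q := by
  refine Finset.card_image_le.trans ?_
  simp

lemma mem_TT {k : ℕ} (x y : V k) : y ∈ TT x (up x y) (up y x) := by
  have h1 := lcp_le x y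
  have h2 := lcp_le y x
  simp only [TT, Finset.mem_image, Finset.mem_univ, true_and]
  have e : x.length - up x y = lcpLen x y := by unfold up; omega
  have hl : (y.drop (lcpLen x y)).length = up y x := by simp [up, lcp_comm y x]
  refine ⟨fun i => (y.drop (lcpLen x y)).get (i.cast hl.symm), ?_⟩
  rw [e, lcp_take]
  conv_rhs => rw [← List.take_append_drop (lcpLen x y) y]
  congr 1
  apply List.ext_get
  · simp [hl]
  · intro n h1 h2
    simp

lemma sph_finite {k : ℕ} (x : V k) (r : ℕ) : (sph x r).Finite := by
  refine Set.Finite.subset (Finset.finite_toSet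
    ((Finset.range (r+1)).biUnion fun q => TT x (r - q) q)) ?_
  intro y hy
  simp only [sph, Set.mem_ofPred_eq, tdist_eq] at hy
  simp only [Finset.coe_biUnion, Set.mem_iUnion]
  refine ⟨up y x, ?_, ?_⟩
  · simp; omega
  · have := mem_TT x y
    have e : up x y = r - up y x := by omega
    rw [e] at this
    exact this

def sphF {k : ℕ} (x : V k) (r : ℕ) : Finset (V k) := (sph_finite x r).toFinset

lemma mem_sphF {k : ℕ} {x y : V k} {r : ℕ} : y ∈ sphF x r ↔ tdist x y = r := by
  simp [sphF, sph]

lemma level_card {k : ℕ} (x : V k) (r q : ℕ) :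
    ((sphF x r).filter (fun y => up y x = q)).card ≤ k ^ q := by
  refine (Finset.card_le_card (t := TT x (r - q) q) ?_).trans (TT_card _ _ _)
  intro y hy
  simp only [Finset.mem_filter, mem_sphF, tdist_eq] at hy
  have := mem_TT x y
  have e : up x y = r - q := by omega
  rwa [e, hy.2] at this

lemma pow_le_card {k : ℕ} (x : V k) (r : ℕ) : k ^ r ≤ (sphF x r).card := by
  have : (Finset.univ.image (fun v : Fin r → Fin k => x ++ List.ofFn v)).card = k ^ r := by
    rw [Finset.card_image_of_injective]
    · simp
    · intro v w h
      simpa using h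
  rw [← this]
  apply Finset.card_le_card
  intro y hy
  simp only [Finset.mem_image, Finset.mem_univ, true_and] at hy
  obtain ⟨v, rfl⟩ := hy
  simp [mem_sphF, tdist, lcp_append]

lemma geomk_le {k : ℕ} (hk : 2 ≤ k) (Q : ℕ) : ∑ q ∈ Finset.range (Q+1), k ^ q ≤ 2 * k ^ Q := by
  induction Q with
  | zero => simp
  | succ n ih =>
    rw [Finset.sum_range_succ]
    have : 2 * k ^ n ≤ k ^ (n+1) := by rw [pow_succ, mul_comm]; gcongr
    omega

lemma geomk_le' {k : ℕ} (hk : 2 ≤ k) (s : Finset ℕ) (Y : ℝ) (hY : 0 ≤ Y)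
    (h : ∀ q ∈ s, (k:ℝ) ^ q ≤ Y) : ((∑ q ∈ s, k ^ q : ℕ) : ℝ) ≤ 2 * Y := by
  rcases s.eq_empty_or_nonempty with rfl | hs
  · simpa using hY
  have h1 : ∑ q ∈ s, k ^ q ≤ 2 * k ^ (s.max' hs) := by
    refine le_trans (Finset.sum_le_sum_of_subset ?_) (geomk_le hk _)
    intro q hq
    have := s.le_max' q hq
    simp; omega
  have h2 := h _ (s.max'_mem hs)
  have h3 : ((∑ q ∈ s, k ^ q : ℕ) : ℝ) ≤ ((2 * k ^ (s.max' hs) : ℕ) : ℝ) := by exact_mod_cast h1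
  push_cast at h3 ⊢
  linarith

lemma up_mem {k : ℕ} {x y : V k} {r : ℕ} (hy : y ∈ sphF x r) :
    up y x ∈ Finset.range (r+1) := by
  rw [mem_sphF, tdist_eq] at hy
  simp; omega

/-- count of near part -/
lemma near_card {k : ℕ} (hk : 2 ≤ k) (x : V k) (r : ℕ) (Y : ℝ) (hY : 0 ≤ Y) :
    (((sphF x r).filter (fun y => (k:ℝ) ^ (up y x) ≤ Y)).card : ℝ) ≤ 2 * Y := by
  refine le_trans ?_ (geomk_le' hk ((Finset.range (r+1)).filter (fun q => (k:ℝ)^q ≤ Y)) Y hY ?_)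
  · rw [Nat.cast_le]
    rw [Finset.card_eq_sum_card_fiberwise (f := fun y => up y x)
      (t := (Finset.range (r+1)).filter (fun q => (k:ℝ)^q ≤ Y))]
    · apply Finset.sum_le_sum
      intro q _
      refine (Finset.card_le_card ?_).trans (level_card x r q)
      intro y hy
      simp only [Finset.mem_filter] at hy ⊢
      exact ⟨hy.1.1, hy.2⟩
    · intro y hy
      simp only [Finset.coe_filter, Set.mem_ofPred_eq] at hy ⊢
      exact ⟨up_mem hy.1, hy.2⟩
  · intro q hq
    exact (Finset.mem_filter.1 hq).2

lemma card_le {k : ℕ} (hk : 2 ≤ k) (x : V k) (r : ℕ) :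
    ((sphF x r).card : ℝ) ≤ 2 * (k:ℝ)^r := by
  refine le_trans ?_ (near_card hk x r ((k:ℝ)^r) (by positivity))
  norm_cast
  apply Finset.card_le_card
  intro y hy
  simp only [Finset.mem_filter]
  refine ⟨hy, ?_⟩
  have := Finset.mem_range.1 (up_mem hy)
  exact Nat.pow_le_pow_right (by omega) (by omega)

lemma low_sum {k : ℕ} (hk : 2 ≤ k) (x : V k) (r : ℕ) :
    ∑ y ∈ sphF x r, (k:ℝ) ^ (2 * up x y) ≤ 2 * (k:ℝ) ^ (2 * r) := by
  have : ∑ y ∈ sphF x r, k ^ (2 * up x y) ≤ 2 * k ^ (2 * r) := by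
    rw [← Finset.sum_fiberwise_of_maps_to (g := fun y => up y x) (fun y hy => up_mem hy)]
    calc _ ≤ ∑ q ∈ Finset.range (r+1), k ^ r * k ^ (r - q) := by
          apply Finset.sum_le_sum
          intro q hq
          have hq := Finset.mem_range.1 hq
          calc _ ≤ ∑ y ∈ (sphF x r).filter (fun y => up y x = q), k ^ (2 * (r - q)) := by
                apply Finset.sum_le_sum
                intro y hy
                simp only [Finset.mem_filter, mem_sphF, tdist_eq] at hy
                exact Nat.pow_le_pow_right (by omega) (by omega)
            _ ≤ k ^ q * k ^ (2 * (r - q)) := by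
                rw [Finset.sum_const, smul_eq_mul]
                gcongr
                exact level_card x r q
            _ = _ := by
                rw [← pow_add, ← pow_add]; congr 1; omega
      _ = k ^ r * ∑ q ∈ Finset.range (r+1), k ^ q := by
          rw [← Finset.mul_sum]
          congr 1
          have := Finset.sum_range_reflect (fun q => k ^ q) (r+1)
          simpa using this
      _ ≤ k ^ r * (2 * k ^ r) := by gcongr; exact geomk_le hk r
      _ = _ := by ring
  exact_mod_cast this

/-- pointwise lemma -/
lemma pointwise {k : ℕ} (hk : 2 ≤ k) (x : V k) (r : ℕ) (φ : V k → ℝ)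
    (h0 : ∀ y, 0 ≤ φ y) (h : ((sphF x r).card : ℝ) ≤ ∑ y ∈ sphF x r, φ y) :
    (k:ℝ)^r / 4 ≤ ∑ y ∈ (sphF x r).filter (fun y => 1/2 ≤ φ y ∧
      (k:ℝ) ^ (2 * up x y) ≤ 8 * min (φ y) (k^r) * k ^ r), min (φ y) ((k:ℝ)^r) := by
  have hk1 : (1:ℝ) ≤ k := by exact_mod_cast (by omega : 1 ≤ k)
  have hK : (1:ℝ) ≤ (k:ℝ)^r := one_le_pow₀ hk1
  have hg0 : ∀ y, 0 ≤ min (φ y) ((k:ℝ)^r) := fun y => le_min (h0 y) (by positivity)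
  by_cases hc : ∃ y ∈ sphF x r, (k:ℝ)^r ≤ φ y
  · obtain ⟨y, hy, hyk⟩ := hc
    have e : min (φ y) ((k:ℝ)^r) = k ^ r := min_eq_right hyk
    have hm : y ∈ (sphF x r).filter (fun y => 1/2 ≤ φ y ∧
      (k:ℝ) ^ (2 * up x y) ≤ 8 * min (φ y) (k^r) * k ^ r) := by
      rw [Finset.mem_filter, e]
      refine ⟨hy, by linarith, ?_⟩
      have h1 : (k:ℝ) ^ (2 * up x y) ≤ k ^ (2 * r) := by
        apply pow_le_pow_right₀ hk1
        rw [mem_sphF, tdist_eq] at hy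
        omega
      have h2 : (k:ℝ) ^ (2 * r) = k^r * k^r := by ring
      nlinarith
    refine le_trans ?_ (Finset.single_le_sum (f := fun y => min (φ y) ((k:ℝ)^r))
      (fun i _ => hg0 i) hm)
    simp only [e]; linarith
  · push Not at hc
    have hp : ∀ y ∈ sphF x r, φ y ≤ (if (1/2 ≤ φ y ∧
      (k:ℝ) ^ (2 * up x y) ≤ 8 * min (φ y) (k^r) * k ^ r) then min (φ y) ((k:ℝ)^r) else 0) + 1/2
        + (k:ℝ) ^ (2 * up x y) / (8 * k^r) := by
      intro y hy
      have e : min (φ y) ((k:ℝ)^r) = φ y := min_eq_left (hc y hy).le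
      rw [e]
      have hpos : 0 ≤ (k:ℝ) ^ (2 * up x y) / (8 * k^r) := by positivity
      split_ifs with hh
      · linarith
      · rw [not_and_or] at hh
        rcases hh with hh | hh
        · linarith
        · have : φ y ≤ (k:ℝ) ^ (2 * up x y) / (8 * k^r) := by
            rw [le_div_iff₀ (by positivity)]; linarith
          linarith
    have hs := Finset.sum_le_sum hp
    rw [Finset.sum_add_distrib, Finset.sum_add_distrib, ← Finset.sum_filter] at hs
    have hl : (∑ y ∈ sphF x r, (k:ℝ) ^ (2 * up x y)) / (8 * k^r) ≤ k^r / 4 := by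
      rw [div_le_iff₀ (by positivity)]
      refine (low_sum hk x r).trans (le_of_eq ?_)
      ring
    rw [Finset.sum_div] at hl
    have hcd : (k:ℝ)^r ≤ (sphF x r).card := by exact_mod_cast pow_le_card x r
    simp only [Finset.sum_const, nsmul_eq_mul] at hs
    linarith

lemma wsum_sph {k : ℕ} (f : V k → ℝ≥0∞) (x : V k) (r : ℕ) :
    wsum f (sph x r) = ∑ y ∈ sphF x r, f y := by
  have h : sph x r = ((sphF x r : Finset (V k)) : Set (V k)) := by simp [sphF]
  unfold wsum
  rw [h, Finset.tsum_subtype' (sphF x r) f]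

lemma sphCard_eq {k : ℕ} (x : V k) (r : ℕ) : sphCard x r = ((sphF x r).card : ℝ≥0∞) := by
  unfold sphCard sphF
  rw [Set.ncard_eq_toFinset_card _ (sph_finite x r)]

lemma sum_sph_le {k : ℕ} (hk : 2 ≤ k) (f : V k → ℝ≥0∞) (x : V k) (r : ℕ) :
    ∑ y ∈ sphF x r, f y ≤ (6 * (k:ℝ≥0∞)^r) * Msph f x := by
  have h1 : sphAvg f x r ≤ Msph f x := le_iSup (fun r => sphAvg f x r) r
  have hpos : 0 < (sphF x r).card := lt_of_lt_of_le (by positivity) (pow_le_card x r)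
  have h2 : ∑ y ∈ sphF x r, f y = (sphF x r).card * sphAvg f x r := by
    rw [sphAvg, wsum_sph, sphCard_eq, ENNReal.mul_div_cancel]
    · exact_mod_cast hpos.ne'
    · simp
  have h3 : (sphF x r).card ≤ 6 * k ^ r := by
    have := card_le hk x r
    have h : (sphF x r).card ≤ 2 * k ^ r := by exact_mod_cast this
    omega
  have h4 : ((sphF x r).card : ℝ≥0∞) ≤ 6 * (k:ℝ≥0∞)^r := by exact_mod_cast h3
  rw [h2]
  gcongr

lemma holder {k : ℕ} (hk : 2 ≤ k) (s : ℝ) (hs : 1 < s) (w : V k → ℝ≥0∞) (y : V k) (r : ℕ)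
    (g : ℝ) (hg : 0 ≤ g) :
    ∑ x ∈ (sphF y r).filter (fun x => (k:ℝ) ^ (2 * up x y) ≤ 8 * g * k ^ r), w x ≤
      6 * (k:ℝ≥0∞)^r * (ENNReal.ofReal g / (k:ℝ≥0∞)^r) ^ ((1 : ℝ) / (2 * (s / (s - 1)))) *
        MsSph s w y := by
  have hs0 : 0 < s := by linarith
  have hkp : (0:ℝ) < (k:ℝ) := by exact_mod_cast (by omega : 0 < k)
  have hK0 : (0:ℝ) < (k:ℝ)^r := by positivity
  set B := (sphF y r).filter (fun x => (k:ℝ) ^ (2 * up x y) ≤ 8 * g * k ^ r) with hB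
  set a : ℝ≥0∞ := 6 * (k:ℝ≥0∞)^r with ha
  set z : ℝ≥0∞ := (ENNReal.ofReal g / (k:ℝ≥0∞)^r) with hz
  have ha0 : a ≠ 0 := by
    rw [ha]; simp; omega
  have hat : a ≠ ⊤ := by
    rw [ha]; exact ENNReal.mul_ne_top (by simp) (by simp)
  have haR : a = ENNReal.ofReal (6 * (k:ℝ)^r) := by
    rw [ha, ENNReal.ofReal_mul (by norm_num), ENNReal.ofReal_pow hkp.le]
    simp
  have hzR : z = ENNReal.ofReal (g / (k:ℝ)^r) := by
    rw [hz, ENNReal.ofReal_div_of_pos hK0, ENNReal.ofReal_pow hkp.le]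
    simp
  have hcard : (B.card : ℝ≥0∞) ≤ a * z ^ (1/2 : ℝ) := by
    rw [haR, hzR, ENNReal.ofReal_rpow_of_nonneg (by positivity) (by norm_num),
      ← ENNReal.ofReal_mul (by positivity), ← ENNReal.ofReal_natCast]
    apply ENNReal.ofReal_le_ofReal
    have h1 : (B.card : ℝ) ≤ 2 * (3 * (k:ℝ)^r * Real.sqrt (g / (k:ℝ)^r)) := by
      refine le_trans ?_ (near_card hk y r _ (by positivity))
      rw [Nat.cast_le]
      apply Finset.card_le_card
      intro x hx
      rw [hB, Finset.mem_filter] at hx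
      rw [Finset.mem_filter]
      refine ⟨hx.1, ?_⟩
      refine (pow_le_pow_iff_left₀ (by positivity) (by positivity) two_ne_zero).1 ?_
      rw [mul_pow, Real.sq_sqrt (by positivity)]
      have h2 := hx.2
      have e : (3 * (k:ℝ)^r)^2 * (g / (k:ℝ)^r) = 9 * g * k^r := by field_simp; ring
      rw [e]
      have e2 : ((k:ℝ) ^ up x y)^2 = (k:ℝ) ^ (2 * up x y) := by ring
      rw [e2]
      nlinarith [mul_nonneg hg hK0.le]
    rw [← Real.sqrt_eq_rpow]
    linarith
  have hJ := ENNReal.rpow_sum_le_const_mul_sum_rpow B w hs.le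
  have hsum : ∑ x ∈ B, w x ^ s ≤ a * Msph (fun y => w y ^ s) y := by
    refine le_trans (Finset.sum_le_sum_of_subset (Finset.filter_subset _ _)) ?_
    exact sum_sph_le hk (fun y => w y ^ s) y r
  have hJ2 : (∑ x ∈ B, w x) ^ s ≤ (a * z ^ (1/2 : ℝ)) ^ (s-1) * (a * Msph (fun y => w y ^ s) y) := by
    refine hJ.trans ?_
    gcongr
  have hJ3 : ∑ x ∈ B, w x ≤
      ((a * z ^ (1/2 : ℝ)) ^ (s-1) * (a * Msph (fun y => w y ^ s) y)) ^ (1/s) := by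
    rw [one_div s]
    exact (ENNReal.le_rpow_inv_iff hs0).2 hJ2
  refine hJ3.trans (le_of_eq ?_)
  have hi : 0 ≤ 1 / s := by positivity
  rw [ENNReal.mul_rpow_of_nonneg _ _ hi, ENNReal.mul_rpow_of_nonneg _ _ hi,
    ENNReal.mul_rpow_of_nonneg _ _ (by linarith : 0 ≤ s - 1), ENNReal.mul_rpow_of_nonneg _ _ hi,
    ← ENNReal.rpow_mul, ← ENNReal.rpow_mul, ← ENNReal.rpow_mul]
  have e1 : 1 / 2 * (s - 1) * (1 / s) = (1 : ℝ) / (2 * (s / (s - 1))) := by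
    have : s - 1 ≠ 0 := by linarith
    field_simp
  have e2 : a ^ ((s - 1) * (1/s)) * a ^ (1/s) = a := by
    rw [← ENNReal.rpow_add _ _ ha0 hat]
    have : (s - 1) * (1/s) + 1/s = 1 := by field_simp; ring
    rw [this, ENNReal.rpow_one]
  have e1' : 1 / 2 * ((s - 1) * (1 / s)) = (1 : ℝ) / (2 * (s / (s - 1))) := by
    rw [← e1]; ring
  unfold MsSph
  rw [e1']
  calc _ = (a ^ ((s - 1) * (1/s)) * a ^ (1/s)) * z ^ ((1 : ℝ) / (2 * (s / (s - 1)))) *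
        Msph (fun y => w y ^ s) y ^ (1 / s) := by ring
    _ = _ := by rw [e2]

lemma pt_dyadic {k : ℕ} (hk : 2 ≤ k) (s : ℝ) (hs : 1 < s) (r : ℕ) (lam t : ℝ) (hl : 0 < lam)
    (ht : 1/2 ≤ t / lam) (M : ℝ≥0∞) :
    ENNReal.ofReal (min (t / lam) ((k:ℝ)^r)) *
      (ENNReal.ofReal (min (t / lam) ((k:ℝ)^r)) / (k:ℝ≥0∞)^r) ^ ((1 : ℝ) / (2 * (s / (s - 1)))) * M
    ≤ ∑' n : {n : ℕ // 2 ^ n ≤ 2 * k ^ r},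
          ((2 : ℝ≥0∞) ^ (n.1 : ℕ) / (k : ℝ≥0∞) ^ r) ^ ((1 : ℝ) / (2 * (s / (s - 1)))) *
            (2 : ℝ≥0∞) ^ (n.1 : ℕ) * (if (2 : ℝ) ^ ((n.1 : ℝ) - 1) * lam ≤ t then M else 0) := by
  set g := min (t / lam) ((k:ℝ)^r) with hg
  have hk1 : (1:ℝ) ≤ k := by exact_mod_cast (by omega : 1 ≤ k)
  have hK : (1:ℝ) ≤ (k:ℝ)^r := one_le_pow₀ hk1
  have hg2 : 1 ≤ 2 * g := by
    have : 1/2 ≤ g := le_min ht (by linarith)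
    linarith
  obtain ⟨n, hn1, hn2⟩ := exists_nat_pow_near hg2 (one_lt_two)
  have hgt : g ≤ t / lam := min_le_left _ _
  have hgk : g ≤ (k:ℝ)^r := min_le_right _ _
  have hn : 2 ^ n ≤ 2 * k ^ r := by
    have : (2:ℝ)^n ≤ 2 * (k:ℝ)^r := by linarith
    exact_mod_cast this
  have hgn : ENNReal.ofReal g ≤ (2:ℝ≥0∞)^n := by
    have : g ≤ (2:ℝ)^n := by rw [pow_succ] at hn2; linarith
    refine (ENNReal.ofReal_le_ofReal this).trans ?_
    rw [ENNReal.ofReal_pow (by norm_num)]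
    simp
  refine le_trans ?_ (ENNReal.le_tsum ⟨n, hn⟩)
  have hc : (2 : ℝ) ^ ((n : ℝ) - 1) * lam ≤ t := by
    rw [← le_div_iff₀ hl, Real.rpow_sub_one (by norm_num), Real.rpow_natCast]
    linarith
  simp only [hc, if_true]
  have hα : 0 ≤ (1 : ℝ) / (2 * (s / (s - 1))) := by
    have : 0 < s - 1 := by linarith
    positivity
  rw [mul_comm (ENNReal.ofReal g)]
  gcongr

/-- Distributional estimate for the spherical averaging operator `A_r°`:
`w({A_r°f ≥ λ}) ≤ c_s Σ_{n≥0, 1≤2^n≤2k^r} (2^n/k^r)^{1/(2s')} 2^n M_s°w({|f| ≥ 2^{n-1}λ})`. -/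
theorem stmt6 (s : ℝ) (hs : 1 < s) :
    ∃ c : ℝ≥0, ∀ (k : ℕ), 2 ≤ k → ∀ (w : V k → ℝ≥0∞) (f : V k → ℝ) (r : ℕ), 1 ≤ r →
      ∀ lam : ℝ, 0 < lam →
      wsum w {x : V k | ENNReal.ofReal lam ≤ sphAvg (absE f) x r} ≤
        (c : ℝ≥0∞) * ∑' n : {n : ℕ // 2 ^ n ≤ 2 * k ^ r},
          ((2 : ℝ≥0∞) ^ (n.1 : ℕ) / (k : ℝ≥0∞) ^ r) ^ ((1 : ℝ) / (2 * (s / (s - 1)))) *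
            (2 : ℝ≥0∞) ^ (n.1 : ℕ) *
            wsum (MsSph s w) {x : V k | (2 : ℝ) ^ ((n.1 : ℝ) - 1) * lam ≤ |f x|} := by
  classical
  refine ⟨24, ?_⟩
  intro k hk w f r hr lam hl
  have hk1 : (1:ℝ) ≤ k := by exact_mod_cast (by omega : 1 ≤ k)
  have hkp : (0:ℝ) < (k:ℝ) := by linarith
  set K : ℝ≥0∞ := (k:ℝ≥0∞)^r with hKdef
  have hK0 : K ≠ 0 := by
    rw [hKdef]; simp; omega
  have hKt : K ≠ ⊤ := by
    rw [hKdef]; simp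
  set α : ℝ := (1 : ℝ) / (2 * (s / (s - 1))) with hα
  set φ : V k → ℝ := fun y => |f y| / lam with hφ
  have hφ0 : ∀ y, 0 ≤ φ y := fun y => by positivity
  set g : V k → ℝ := fun y => min (φ y) ((k:ℝ)^r) with hg
  have hg0 : ∀ y, 0 ≤ g y := fun y => le_min (hφ0 y) (by positivity)
  set G := {x : V k | ENNReal.ofReal lam ≤ sphAvg (absE f) x r} with hG
  set S : ℝ≥0∞ := ∑' n : {n : ℕ // 2 ^ n ≤ 2 * k ^ r},
          ((2 : ℝ≥0∞) ^ (n.1 : ℕ) / K) ^ α * (2 : ℝ≥0∞) ^ (n.1 : ℕ) *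
            wsum (MsSph s w) {x : V k | (2 : ℝ) ^ ((n.1 : ℝ) - 1) * lam ≤ |f x|} with hS
  let P : V k → V k → Prop := fun x y => tdist x y = r ∧ 1/2 ≤ φ y ∧
    (k:ℝ) ^ (2 * up x y) ≤ 8 * g y * k ^ r
  have hx : ∀ x, K / 4 * G.indicator w x ≤
      ∑' y, if P x y then ENNReal.ofReal (g y) * w x else 0 := by
    intro x
    by_cases hxG : x ∈ G
    · rw [Set.indicator_of_mem hxG]
      have h1 : ((sphF x r).card : ℝ) ≤ ∑ y ∈ sphF x r, φ y := by
        have h2 : ENNReal.ofReal lam ≤ sphAvg (absE f) x r := hxG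
        rw [sphAvg, wsum_sph, sphCard_eq] at h2
        have h3 := ENNReal.mul_le_of_le_div h2
        unfold absE at h3
        rw [← ENNReal.ofReal_sum_of_nonneg (fun i _ => abs_nonneg _), ← ENNReal.ofReal_natCast,
          ← ENNReal.ofReal_mul hl.le, ENNReal.ofReal_le_ofReal_iff
            (Finset.sum_nonneg fun i _ => abs_nonneg _)] at h3
        rw [hφ, ← Finset.sum_div, le_div_iff₀ hl]
        linarith
      have h4 := pointwise hk x r φ hφ0 h1
      have h5 : K / 4 ≤ ∑ y ∈ (sphF x r).filter (fun y => 1/2 ≤ φ y ∧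
          (k:ℝ) ^ (2 * up x y) ≤ 8 * g y * k ^ r), ENNReal.ofReal (g y) := by
        rw [← ENNReal.ofReal_sum_of_nonneg (fun i _ => hg0 i)]
        refine le_trans (le_of_eq ?_) (ENNReal.ofReal_le_ofReal h4)
        rw [ENNReal.ofReal_div_of_pos (by norm_num), ENNReal.ofReal_pow hkp.le]
        simp [hKdef]
      calc K / 4 * w x ≤ (∑ y ∈ (sphF x r).filter (fun y => 1/2 ≤ φ y ∧
          (k:ℝ) ^ (2 * up x y) ≤ 8 * g y * k ^ r), ENNReal.ofReal (g y)) * w x := by gcongr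
        _ = ∑ y ∈ (sphF x r).filter (fun y => 1/2 ≤ φ y ∧
          (k:ℝ) ^ (2 * up x y) ≤ 8 * g y * k ^ r),
            if P x y then ENNReal.ofReal (g y) * w x else 0 := by
            rw [Finset.sum_mul]
            apply Finset.sum_congr rfl
            intro y hy
            rw [Finset.mem_filter, mem_sphF] at hy
            rw [if_pos hy]
        _ ≤ _ := ENNReal.sum_le_tsum _
    · rw [Set.indicator_of_notMem hxG]; simp
  have hy : ∀ y, (∑' x, if P x y then ENNReal.ofReal (g y) * w x else 0) ≤
      6 * K * ∑' n : {n : ℕ // 2 ^ n ≤ 2 * k ^ r},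
          ((2 : ℝ≥0∞) ^ (n.1 : ℕ) / K) ^ α * (2 : ℝ≥0∞) ^ (n.1 : ℕ) *
            (if (2 : ℝ) ^ ((n.1 : ℝ) - 1) * lam ≤ |f y| then MsSph s w y else 0) := by
    intro y
    by_cases hφy : 1/2 ≤ φ y
    · have h1 : (∑' x, if P x y then ENNReal.ofReal (g y) * w x else 0) =
          ENNReal.ofReal (g y) * ∑ x ∈ (sphF y r).filter
            (fun x => (k:ℝ) ^ (2 * up x y) ≤ 8 * g y * k ^ r), w x := by
        rw [Finset.mul_sum, tsum_eq_sum (s := (sphF y r).filter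
            (fun x => (k:ℝ) ^ (2 * up x y) ≤ 8 * g y * k ^ r))]
        · apply Finset.sum_congr rfl
          intro x hx
          rw [Finset.mem_filter, mem_sphF, tdist_comm'] at hx
          rw [if_pos ⟨hx.1, hφy, hx.2⟩]
        · intro x hx
          rw [Finset.mem_filter, mem_sphF, tdist_comm'] at hx
          rw [if_neg]
          rintro ⟨ha, -, hb⟩
          exact hx ⟨ha, hb⟩
      rw [h1]
      have h2 := holder hk s hs w y r (g y) (hg0 y)
      have h3 := pt_dyadic hk s hs r lam (|f y|) hl hφy (MsSph s w y)
      calc _ ≤ ENNReal.ofReal (g y) * (6 * K * (ENNReal.ofReal (g y) / K) ^ α * MsSph s w y) := by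
            gcongr
        _ = 6 * K * (ENNReal.ofReal (g y) * (ENNReal.ofReal (g y) / K) ^ α * MsSph s w y) := by
            ring
        _ ≤ _ := by gcongr
    · have h1 : ∀ x, (if P x y then ENNReal.ofReal (g y) * w x else 0) = 0 := by
        intro x
        rw [if_neg]
        rintro ⟨-, h, -⟩
        exact hφy h
      simp [h1]
  have hmain : K / 4 * wsum w G ≤ 6 * K * S := by
    calc K / 4 * wsum w G = ∑' x, K / 4 * G.indicator w x := by
          rw [ENNReal.tsum_mul_left, wsum, tsum_subtype]
      _ ≤ ∑' x, ∑' y, if P x y then ENNReal.ofReal (g y) * w x else 0 :=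
          ENNReal.tsum_le_tsum hx
      _ = ∑' y, ∑' x, if P x y then ENNReal.ofReal (g y) * w x else 0 := ENNReal.tsum_comm
      _ ≤ _ := ENNReal.tsum_le_tsum hy
      _ = 6 * K * S := by
          rw [ENNReal.tsum_mul_left, ENNReal.tsum_comm, hS]
          congr 1
          apply tsum_congr
          intro n
          rw [ENNReal.tsum_mul_left, wsum, tsum_subtype]
          congr 1
  have h4 : (4:ℝ≥0∞) / K * (K / 4) = 1 := by
    rw [← mul_div_assoc, ENNReal.div_mul_cancel hK0 hKt]
    exact ENNReal.div_self (by norm_num) (by norm_num)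
  calc wsum w G = 4 / K * (K / 4 * wsum w G) := by rw [← mul_assoc, h4, one_mul]
    _ ≤ 4 / K * (6 * K * S) := by gcongr
    _ = (4 / K * K) * 6 * S := by ring
    _ = _ := by
      rw [ENNReal.div_mul_cancel hK0 hKt]
      norm_num
end
end

section
/- Let T be the infinite rooted k-ary tree with k ≥ 2 and let w be a weight such that for some s > 1, M_s w(x) ≤ C w(x) for all x ∈ T. Then the maximal operator M satisfies the weighted weak-type (1,1) estimate: w({x : Mf(x) > λ}) ≲ (1/λ) Σ_{x∈T} |f(x)| w(x) for all f ∈ L¹(w) and λ > 0. -/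
open scoped ENNReal NNReal BigOperators

noncomputable section

/-- Vertices reached from `y` by going up `j` levels and then down `i` levels. -/
def Dn {k : ℕ} (y : V k) (j i : ℕ) : Finset (V k) :=
  if j ≤ y.length then
    (Finset.univ : Finset (Fin i → Fin k)).image (fun v => y.take (y.length - j) ++ List.ofFn v)
  else ∅

lemma mem_Dn {k : ℕ} (x y : V k) (j i : ℕ) :
    x ∈ Dn y j i ↔ ∃ p u v : V k, y = p ++ u ∧ x = p ++ v ∧ u.length = j ∧ v.length = i := by
  unfold Dn
  constructor
  · intro h
    split_ifs at h with hj
    · simp only [Finset.mem_image, Finset.mem_univ, true_and] at h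
      obtain ⟨v, rfl⟩ := h
      refine ⟨y.take (y.length - j), y.drop (y.length - j), List.ofFn v, by simp, rfl, ?_, by simp⟩
      simp; omega
    · simp at h
  · rintro ⟨p, u, v, rfl, rfl, rfl, rfl⟩
    have : u.length ≤ (p ++ u).length := by simp
    rw [if_pos this]
    simp only [Finset.mem_image, Finset.mem_univ, true_and]
    refine ⟨fun a => v.get a, ?_⟩
    simp

lemma Dn_symm {k : ℕ} (x y : V k) (j i : ℕ) : x ∈ Dn y j i ↔ y ∈ Dn x i j := by
  rw [mem_Dn, mem_Dn]
  constructor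
  · rintro ⟨p, u, v, h1, h2, h3, h4⟩
    exact ⟨p, v, u, h2, h1, h4, h3⟩
  · rintro ⟨p, u, v, h1, h2, h3, h4⟩
    exact ⟨p, v, u, h2, h1, h4, h3⟩

lemma card_Dn {k : ℕ} (y : V k) (j i : ℕ) : (Dn y j i).card ≤ k ^ i := by
  unfold Dn
  split_ifs
  · refine Finset.card_image_le.trans ?_
    simp
  · simp

lemma lcp_append_s8 {k : ℕ} (p u v : V k) : p.length ≤ lcpLen (p ++ u) (p ++ v) := by
  induction p with
  | nil => simp
  | cons a p ih => simp [lcpLen, ih]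

lemma lcp_exists {k : ℕ} (x y : V k) :
    ∃ p u v : V k, x = p ++ u ∧ y = p ++ v ∧ p.length = lcpLen x y := by
  induction x generalizing y with
  | nil => exact ⟨[], [], y, by simp, by simp, by simp [lcpLen]⟩
  | cons a x ih =>
    cases y with
    | nil => exact ⟨[], a :: x, [], by simp, by simp, by simp [lcpLen]⟩
    | cons b y =>
      by_cases h : a = b
      · obtain ⟨p, u, v, h1, h2, h3⟩ := ih y
        subst h
        exact ⟨a :: p, u, v, by simp [← h1], by simp [← h2], by simp [lcpLen, h3]⟩
      · exact ⟨[], a :: x, b :: y, by simp, by simp, by simp [lcpLen, h]⟩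

lemma tdist_Dn {k : ℕ} {x y : V k} {j i : ℕ} (h : x ∈ Dn y j i) : tdist y x ≤ j + i := by
  rw [mem_Dn] at h
  obtain ⟨p, u, v, rfl, rfl, rfl, rfl⟩ := h
  have := lcp_append_s8 p u v
  unfold tdist
  simp only [List.length_append]
  omega

lemma exists_Dn {k : ℕ} (y x : V k) : ∃ j i, j + i = tdist y x ∧ x ∈ Dn y j i := by
  obtain ⟨p, u, v, h1, h2, h3⟩ := lcp_exists y x
  refine ⟨u.length, v.length, ?_, ?_⟩
  · unfold tdist
    rw [← h3]
    have e1 : y.length = p.length + u.length := by rw [h1, List.length_append]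
    have e2 : x.length = p.length + v.length := by rw [h2, List.length_append]
    omega
  · rw [mem_Dn]
    exact ⟨p, u, v, h1, h2, rfl, rfl⟩

lemma geomNat_le (k : ℕ) (hk : 2 ≤ k) (r : ℕ) : ∑ m ∈ Finset.range (r + 1), k ^ m ≤ 2 * k ^ r := by
  induction r with
  | zero => simp
  | succ r ih =>
    rw [Finset.sum_range_succ, pow_succ]
    nlinarith [Nat.mul_le_mul_left (k ^ r) hk]

/-- a finite superset of the ball -/
def Bf {k : ℕ} (y : V k) (r : ℕ) : Finset (V k) :=
  (Finset.range (r + 1)).biUnion fun j => (Finset.range (r - j + 1)).biUnion fun i => Dn y j i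

lemma ball_subset_Bf {k : ℕ} (y : V k) (r : ℕ) : ball y r ⊆ (Bf y r : Set (V k)) := by
  intro x hx
  obtain ⟨j, i, h1, h2⟩ := exists_Dn y x
  have : tdist y x ≤ r := hx
  simp only [Bf, Finset.coe_biUnion, Set.mem_iUnion, Finset.coe_range, Set.mem_Iio]
  exact ⟨j, by omega, i, by omega, h2⟩

lemma card_Bf {k : ℕ} (hk : 2 ≤ k) (y : V k) (r : ℕ) : (Bf y r).card ≤ 4 * k ^ r := by
  unfold Bf
  refine Finset.card_biUnion_le.trans ?_
  calc _ ≤ ∑ j ∈ Finset.range (r + 1), 2 * k ^ (r - j) := by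
        refine Finset.sum_le_sum fun j hj => ?_
        refine Finset.card_biUnion_le.trans ?_
        exact (Finset.sum_le_sum fun i _ => card_Dn y j i).trans (geomNat_le k hk _)
    _ = 2 * ∑ j ∈ Finset.range (r + 1), k ^ j := by
        rw [← Finset.mul_sum]
        congr 1
        exact Finset.sum_range_reflect (fun j => k ^ j) (r + 1) ▸ by
          refine Finset.sum_congr rfl fun j hj => ?_
          congr 1
    _ ≤ _ := by have := geomNat_le k hk r; omega

lemma ball_finite {k : ℕ} (y : V k) (r : ℕ) : (ball y r).Finite :=
  (Finset.finite_toSet _).subset (ball_subset_Bf y r)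

lemma ballCard_le {k : ℕ} (hk : 2 ≤ k) (y : V k) (r : ℕ) : ballCard y r ≤ 4 * (k : ℝ≥0∞) ^ r := by
  unfold ballCard
  have h : (ball y r).ncard ≤ 4 * k ^ r := by
    refine (Set.ncard_le_ncard (ball_subset_Bf y r) (Finset.finite_toSet _)).trans ?_
    rw [Set.ncard_coe_finset]
    exact card_Bf hk y r
  exact_mod_cast h

lemma le_ballCard {k : ℕ} (y : V k) (r : ℕ) : (k : ℝ≥0∞) ^ r ≤ ballCard y r := by
  unfold ballCard
  have h : k ^ r ≤ (ball y r).ncard := by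
    have e : (Dn y 0 r).card = k ^ r := by
      unfold Dn
      rw [if_pos (Nat.zero_le _), Finset.card_image_of_injective]
      · simp
      · intro a b hab
        simpa using hab
    rw [← e, ← Set.ncard_coe_finset]
    refine Set.ncard_le_ncard ?_ (ball_finite y r)
    intro x hx
    have := tdist_Dn (Finset.mem_coe.1 hx)
    show tdist y x ≤ r
    omega
  exact_mod_cast h

/-- Weighted size of `Dn`. -/
lemma w_Dn {k : ℕ} (hk : 2 ≤ k) (w : V k → ℝ≥0∞) (s : ℝ) (hs : 1 < s)
    (C : ℝ≥0) (hC : ∀ x : V k, MsBall s w x ≤ (C : ℝ≥0∞) * w x) (y : V k) (j i : ℕ) :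
    ∑ x ∈ Dn y j i, w x ≤
      4 * C * (k : ℝ≥0∞) ^ (i + j) * ((k : ℝ≥0∞) ^ (-((s - 1) / s))) ^ j * w y := by
  have hs0 : 0 < s := by linarith
  have hk0 : (k : ℝ≥0∞) ≠ 0 := by simp; omega
  have hkt : (k : ℝ≥0∞) ≠ ⊤ := by simp
  have h1 : wsum (fun y => w y ^ s) (ball y (j + i)) ≤
      4 * (k : ℝ≥0∞) ^ (j + i) * (C * w y) ^ s := by
    have h := hC y
    unfold MsBall at h
    rw [one_div, ENNReal.rpow_inv_le_iff hs0] at h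
    have h2 := (le_iSup (fun r => wsum (fun y => w y ^ s) (ball y r) / ballCard y r) (j + i)).trans h
    have b0 : ballCard y (j + i) ≠ 0 := by
      intro h0
      have := le_ballCard y (j + i)
      rw [h0] at this
      simp at this
      omega
    have bt : ballCard y (j + i) ≠ ⊤ := by simp [ballCard]
    rw [ENNReal.div_le_iff b0 bt, mul_comm] at h2
    exact h2.trans (by gcongr; exact ballCard_le hk y _)
  have h3 : ∑ x ∈ Dn y j i, w x ^ s ≤ wsum (fun y => w y ^ s) (ball y (j + i)) := by
    unfold wsum
    rw [← Finset.tsum_subtype]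
    have hsub : (↑(Dn y j i) : Set (V k)) ⊆ ball y (j + i) :=
      fun x hx => tdist_Dn (Finset.mem_coe.1 hx)
    exact ENNReal.tsum_mono_subtype (fun y => w y ^ s) hsub
  have h4 := ENNReal.rpow_sum_le_const_mul_sum_rpow (Dn y j i) w hs.le
  rw [← ENNReal.rpow_le_rpow_iff hs0]
  refine h4.trans ?_
  have h5 : ((Dn y j i).card : ℝ≥0∞) ^ (s - 1) ≤ ((k : ℝ≥0∞) ^ i) ^ (s - 1) := by
    apply ENNReal.rpow_le_rpow _ (by linarith)
    exact_mod_cast card_Dn y j i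
  refine (mul_le_mul' h5 (h3.trans h1)).trans ?_
  have h6 : (k : ℝ≥0∞) ^ (j + i) * ((k : ℝ≥0∞) ^ i) ^ (s - 1) =
      ((k : ℝ≥0∞) ^ (i + j) * ((k : ℝ≥0∞) ^ (-((s - 1) / s))) ^ j) ^ s := by
    rw [ENNReal.mul_rpow_of_nonneg _ _ hs0.le]
    simp only [← ENNReal.rpow_natCast, ← ENNReal.rpow_mul]
    rw [← ENNReal.rpow_add _ _ hk0 hkt, ← ENNReal.rpow_add _ _ hk0 hkt]
    congr 1
    push_cast
    field_simp
    ring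
  have h7 : (4 : ℝ≥0∞) ≤ 4 ^ s := by
    conv_lhs => rw [← ENNReal.rpow_one 4]
    exact ENNReal.rpow_le_rpow_of_exponent_le (by norm_num) hs.le
  calc _ = 4 * ((k : ℝ≥0∞) ^ (j + i) * ((k : ℝ≥0∞) ^ i) ^ (s - 1)) * (C * w y) ^ s := by ring
    _ ≤ 4 ^ s * ((k : ℝ≥0∞) ^ (i + j) * ((k : ℝ≥0∞) ^ (-((s - 1) / s))) ^ j) ^ s
        * (C * w y) ^ s := by rw [h6]; gcongr
    _ = _ := by
      rw [← ENNReal.mul_rpow_of_nonneg _ _ hs0.le, ← ENNReal.mul_rpow_of_nonneg _ _ hs0.le]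
      congr 1
      ring

/-- The scalar sum over radii. -/
lemma scalar_sum (k : ℕ) (hk : 2 ≤ k) (g l : ℝ≥0∞) (hg : g ≠ ⊤) (hl : l ≠ 0) (hlt : l ≠ ⊤)
    (n : ℕ) :
    ∑' r : ℕ, (if l * (k : ℝ≥0∞) ^ r < g * (k : ℝ≥0∞) ^ n then min g (l * (k : ℝ≥0∞) ^ r) else 0)
      ≤ (n + 2) * g := by
  have hk1 : (1 : ℝ≥0∞) ≤ k := by exact_mod_cast (by omega : 1 ≤ k)
  have ex : ∃ N : ℕ, g ≤ l * (k : ℝ≥0∞) ^ N := by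
    have ht : Filter.Tendsto (fun N : ℕ => (k : ℝ≥0∞) ^ N) Filter.atTop (nhds ⊤) :=
      ENNReal.tendsto_pow_atTop_nhds_top_iff.2 (by exact_mod_cast (by omega : 1 < k))
    have hd : g / l < ⊤ := ENNReal.div_lt_top hg hl
    obtain ⟨N, hN⟩ := (ht.eventually (lt_mem_nhds hd)).exists
    refine ⟨N, ?_⟩
    rw [mul_comm]
    exact (ENNReal.div_le_iff hl hlt).1 hN.le
  classical
  let N := Nat.find ex
  have hN : g ≤ l * (k : ℝ≥0∞) ^ N := Nat.find_spec ex
  have hsupp : ∀ r ∉ Finset.range (N + n), (if l * (k : ℝ≥0∞) ^ r < g * (k : ℝ≥0∞) ^ n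
      then min g (l * (k : ℝ≥0∞) ^ r) else 0) = 0 := by
    intro r hr
    rw [if_neg]
    rw [not_lt]
    simp at hr
    calc g * (k : ℝ≥0∞) ^ n ≤ l * (k : ℝ≥0∞) ^ N * (k : ℝ≥0∞) ^ n := by gcongr
      _ = l * (k : ℝ≥0∞) ^ (N + n) := by rw [pow_add]; ring
      _ ≤ _ := by gcongr
  rw [tsum_eq_sum hsupp, Finset.sum_range_add]
  have p1 : ∑ r ∈ Finset.range N, (if l * (k : ℝ≥0∞) ^ r < g * (k : ℝ≥0∞) ^ n
      then min g (l * (k : ℝ≥0∞) ^ r) else 0) ≤ 2 * g := by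
    rcases Nat.eq_zero_or_pos N with h0 | h0
    · rw [h0]; simp
    · obtain ⟨M, hM⟩ : ∃ M, N = M + 1 := ⟨N - 1, by omega⟩
      have hlt' : l * (k : ℝ≥0∞) ^ M < g := not_le.1 (Nat.find_min ex (by show M < N; omega))
      rw [hM]
      calc _ ≤ ∑ r ∈ Finset.range (M + 1), l * (k : ℝ≥0∞) ^ r := by
            refine Finset.sum_le_sum fun r _ => ?_
            split_ifs
            · exact min_le_right _ _
            · exact zero_le
        _ = l * ((∑ r ∈ Finset.range (M + 1), k ^ r : ℕ) : ℝ≥0∞) := by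
            rw [← Finset.mul_sum]; push_cast; rfl
        _ ≤ l * ((2 * k ^ M : ℕ) : ℝ≥0∞) := by
            gcongr; exact geomNat_le k hk M
        _ = 2 * (l * (k : ℝ≥0∞) ^ M) := by push_cast; ring
        _ ≤ _ := by gcongr
  have p2 : ∑ r ∈ Finset.range n, (if l * (k : ℝ≥0∞) ^ (N + r) < g * (k : ℝ≥0∞) ^ n
      then min g (l * (k : ℝ≥0∞) ^ (N + r)) else 0) ≤ n * g := by
    refine (Finset.sum_le_card_nsmul _ _ g fun r _ => ?_).trans (by simp)
    split_ifs
    · exact min_le_left _ _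
    · exact zero_le
  calc _ ≤ 2 * g + n * g := add_le_add p1 p2
    _ = _ := by ring

lemma sum_biUnion_le' {ι α : Type*} [DecidableEq α] (S : Finset ι) (t : ι → Finset α)
    (g : α → ℝ≥0∞) : ∑ y ∈ S.biUnion t, g y ≤ ∑ m ∈ S, ∑ y ∈ t m, g y := by
  classical
  induction S using Finset.induction_on with
  | empty => simp
  | insert a S ha ih =>
    rw [Finset.biUnion_insert, Finset.sum_insert ha]
    refine le_trans ?_ (add_le_add_right ih _)
    rw [← Finset.sum_union_inter]
    exact le_self_add

/-- Some sphere has a large mean. -/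
lemma exists_sphere {k : ℕ} (hk : 2 ≤ k) (g : V k → ℝ≥0∞) (l : ℝ≥0∞) (x : V k)
    (h : l < Mball g x) : ∃ m : ℕ, l * (k : ℝ≥0∞) ^ m < 2 * 
      ∑ j ∈ Finset.range (m + 1), ∑ y ∈ Dn x (m - j) j, g y := by
  unfold Mball at h
  rw [lt_iSup_iff] at h
  obtain ⟨r, hr⟩ := h
  by_contra! hcon
  refine absurd hr (not_lt.2 ?_)
  apply ENNReal.div_le_of_le_mul
  refine le_trans ?_ (mul_le_mul_right (le_ballCard x r) l)
  have hb : wsum g (ball x r) ≤ ∑ m ∈ Finset.range (r + 1),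
      ∑ j ∈ Finset.range (m + 1), ∑ y ∈ Dn x (m - j) j, g y := by
    classical
    have : ball x r ⊆ ((Finset.range (r + 1)).biUnion fun m =>
        (Finset.range (m + 1)).biUnion fun j => Dn x (m - j) j : Finset (V k)) := by
      intro y hy
      obtain ⟨a, b, h1, h2⟩ := exists_Dn x y
      have : tdist x y ≤ r := hy
      simp only [Finset.coe_biUnion, Set.mem_iUnion, Finset.coe_range, Set.mem_Iio]
      refine ⟨a + b, by omega, b, by omega, ?_⟩
      simpa using h2
    unfold wsum
    refine (ENNReal.tsum_mono_subtype g this).trans ?_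
    rw [Finset.tsum_subtype']
    refine (sum_biUnion_le' _ _ _).trans ?_
    refine Finset.sum_le_sum fun m _ => ?_
    exact sum_biUnion_le' _ _ _
  refine hb.trans ?_
  have h2 : 2 * ∑ m ∈ Finset.range (r + 1),
      ∑ j ∈ Finset.range (m + 1), ∑ y ∈ Dn x (m - j) j, g y ≤ 2 * (l * (k : ℝ≥0∞) ^ r) := by
    rw [Finset.mul_sum]
    calc _ ≤ ∑ m ∈ Finset.range (r + 1), l * (k : ℝ≥0∞) ^ m := Finset.sum_le_sum fun m _ => hcon m
      _ = l * ((∑ m ∈ Finset.range (r + 1), k ^ m : ℕ) : ℝ≥0∞) := by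
            rw [← Finset.mul_sum]; push_cast; rfl
      _ ≤ l * ((2 * k ^ r : ℕ) : ℝ≥0∞) := by
            gcongr; exact geomNat_le k hk r
      _ = _ := by push_cast; ring
  exact (ENNReal.mul_le_mul_iff_right (by norm_num) (by norm_num)).1 h2

/-- Truncated and restricted version of `g`. -/
def Hf {k : ℕ} (g : V k → ℝ≥0∞) (l : ℝ≥0∞) (i j : ℕ) (y : V k) : ℝ≥0∞ :=
  if l * (k : ℝ≥0∞) ^ (i + j) < g y * (k : ℝ≥0∞) ^ (2 * j + 3)
    then min (g y) (l * (k : ℝ≥0∞) ^ (i + j)) else 0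

lemma geom_small (k : ℕ) (hk : 2 ≤ k) (m : ℕ) :
    ∑ j ∈ Finset.range (m + 1), (k : ℝ≥0∞) ^ j * ((k : ℝ≥0∞) ^ (2 * j + 3))⁻¹ ≤ 4⁻¹ := by
  have hk0 : (k : ℝ≥0∞) ≠ 0 := by simp; omega
  have hkt : (k : ℝ≥0∞) ≠ ⊤ := by simp
  have hk2 : (k : ℝ≥0∞)⁻¹ ≤ 2⁻¹ := ENNReal.inv_le_inv.2 (by exact_mod_cast hk)
  calc _ ≤ ∑ j ∈ Finset.range (m + 1), (4⁻¹ : ℝ≥0∞) * (2⁻¹ : ℝ≥0∞) ^ (j + 1) := by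
        refine Finset.sum_le_sum fun j _ => ?_
        have e : (k : ℝ≥0∞) ^ j * ((k : ℝ≥0∞) ^ (2 * j + 3))⁻¹ = (k : ℝ≥0∞)⁻¹ ^ (j + 3) := by
          rw [show 2 * j + 3 = j + (j + 3) by ring, pow_add,
            ENNReal.mul_inv (Or.inl (pow_ne_zero _ hk0)) (Or.inl (ENNReal.pow_ne_top hkt)),
            ← mul_assoc, ENNReal.mul_inv_cancel (pow_ne_zero _ hk0) (ENNReal.pow_ne_top hkt),
            one_mul, ENNReal.inv_pow]
        rw [e]
        calc _ ≤ (2⁻¹ : ℝ≥0∞) ^ (j + 3) := by gcongr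
          _ = (2⁻¹ : ℝ≥0∞) ^ 2 * 2⁻¹ ^ (j + 1) := by rw [← pow_add]; congr 1; omega
          _ = _ := by
            congr 1
            rw [← ENNReal.inv_pow]; norm_num
    _ = 4⁻¹ * ∑ j ∈ Finset.range (m + 1), (2⁻¹ : ℝ≥0∞) ^ (j + 1) := by rw [Finset.mul_sum]
    _ ≤ 4⁻¹ * 1 := by
        gcongr
        refine (ENNReal.sum_le_tsum _).trans ?_
        rw [ENNReal.tsum_geometric_add_one]
        simp
    _ = _ := mul_one _

lemma pointwise_a {k : ℕ} (hk : 2 ≤ k) (g : V k → ℝ≥0∞) (l : ℝ≥0∞) (hlt : l ≠ ⊤) (x : V k)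
    (h : l < Mball g x) : ∃ m : ℕ, l * (k : ℝ≥0∞) ^ m ≤ 4 *
      ∑ j ∈ Finset.range (m + 1), ∑ y ∈ Dn x (m - j) j, Hf g l (m - j) j y := by
  have hk0 : (k : ℝ≥0∞) ≠ 0 := by simp; omega
  have hkt : (k : ℝ≥0∞) ≠ ⊤ := by simp
  obtain ⟨m, hm⟩ := exists_sphere hk g l x h
  refine ⟨m, ?_⟩
  by_cases hc : ∃ j ∈ Finset.range (m + 1), ∃ y ∈ Dn x (m - j) j,
      Hf g l (m - j) j y = l * (k : ℝ≥0∞) ^ m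
  · obtain ⟨j, hj, y, hy, e⟩ := hc
    rw [← e]
    calc Hf g l (m - j) j y ≤ ∑ y ∈ Dn x (m - j) j, Hf g l (m - j) j y :=
          Finset.single_le_sum (f := Hf g l (m - j) j) (fun _ _ => zero_le) hy
      _ ≤ ∑ j ∈ Finset.range (m + 1), ∑ y ∈ Dn x (m - j) j, Hf g l (m - j) j y :=
          Finset.single_le_sum (f := fun j => ∑ y ∈ Dn x (m - j) j, Hf g l (m - j) j y)
            (fun _ _ => zero_le) hj
      _ ≤ _ := le_mul_of_one_le_left zero_le (by norm_num)
  · push Not at hc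
    set A := l * (k : ℝ≥0∞) ^ m with hA
    have hAt : A ≠ ⊤ := ENNReal.mul_ne_top hlt (ENNReal.pow_ne_top hkt)
    set S := ∑ j ∈ Finset.range (m + 1), ∑ y ∈ Dn x (m - j) j, Hf g l (m - j) j y with hS
    have key : ∑ j ∈ Finset.range (m + 1), ∑ y ∈ Dn x (m - j) j, g y ≤ S + A * 4⁻¹ := by
      calc _ ≤ ∑ j ∈ Finset.range (m + 1), (∑ y ∈ Dn x (m - j) j, Hf g l (m - j) j y +
            A * ((k : ℝ≥0∞) ^ j * ((k : ℝ≥0∞) ^ (2 * j + 3))⁻¹)) := by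
            refine Finset.sum_le_sum fun j hj => ?_
            have hjm : m - j + j = m := by simp at hj; omega
            calc _ ≤ ∑ y ∈ Dn x (m - j) j, (Hf g l (m - j) j y +
                  A * ((k : ℝ≥0∞) ^ (2 * j + 3))⁻¹) := by
                  refine Finset.sum_le_sum fun y hy => ?_
                  have hne := hc j hj y hy
                  unfold Hf at hne ⊢
                  rw [hjm, ← hA] at hne ⊢
                  split_ifs at hne ⊢ with hb
                  · rcases le_total (g y) A with h1 | h1
                    · rw [min_eq_left h1]; exact le_self_add
                    · rw [min_eq_right h1] at hne; exact absurd rfl hne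
                  · rw [zero_add, ← div_eq_mul_inv]
                    rw [ENNReal.le_div_iff_mul_le (Or.inl (pow_ne_zero _ hk0))
                      (Or.inl (ENNReal.pow_ne_top hkt))]
                    exact not_lt.1 hb
              _ = ∑ y ∈ Dn x (m - j) j, Hf g l (m - j) j y +
                  (Dn x (m - j) j).card * (A * ((k : ℝ≥0∞) ^ (2 * j + 3))⁻¹) := by
                  rw [Finset.sum_add_distrib]; simp
              _ ≤ ∑ y ∈ Dn x (m - j) j, Hf g l (m - j) j y +
                  (k : ℝ≥0∞) ^ j * (A * ((k : ℝ≥0∞) ^ (2 * j + 3))⁻¹) := by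
                  gcongr
                  exact_mod_cast card_Dn x (m - j) j
              _ = _ := by ring
        _ = S + A * ∑ j ∈ Finset.range (m + 1),
              (k : ℝ≥0∞) ^ j * ((k : ℝ≥0∞) ^ (2 * j + 3))⁻¹ := by
            rw [Finset.sum_add_distrib, Finset.mul_sum]
        _ ≤ _ := by gcongr; exact geom_small k hk m
    have h2 : A + A ≤ 4 * S + A := by
      calc A + A = 2 * A := by ring
        _ ≤ 2 * (2 * (S + A * 4⁻¹)) := by
            gcongr
            exact hm.le.trans (by gcongr)
        _ = 4 * S + A * (4 * 4⁻¹) := by ring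
        _ = _ := by rw [ENNReal.mul_inv_cancel (by norm_num) (by norm_num), mul_one]
    exact (ENNReal.add_le_add_iff_right hAt).1 h2

lemma pointwise_b {k : ℕ} (hk : 2 ≤ k) (g : V k → ℝ≥0∞) (l : ℝ≥0∞) (hl : l ≠ 0) (hlt : l ≠ ⊤)
    (x : V k) (h : l < Mball g x) : 1 ≤ 4 *
      ∑' j : ℕ, ∑' i : ℕ, (l * (k : ℝ≥0∞) ^ (i + j))⁻¹ * ∑ y ∈ Dn x i j, Hf g l i j y := by
  have hk0 : (k : ℝ≥0∞) ≠ 0 := by simp; omega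
  have hkt : (k : ℝ≥0∞) ≠ ⊤ := by simp
  obtain ⟨m, hm⟩ := pointwise_a hk g l hlt x h
  have hA0 : l * (k : ℝ≥0∞) ^ m ≠ 0 := mul_ne_zero hl (pow_ne_zero _ hk0)
  have hAt : l * (k : ℝ≥0∞) ^ m ≠ ⊤ := ENNReal.mul_ne_top hlt (ENNReal.pow_ne_top hkt)
  calc 1 = (l * (k : ℝ≥0∞) ^ m)⁻¹ * (l * (k : ℝ≥0∞) ^ m) := (ENNReal.inv_mul_cancel hA0 hAt).symm
    _ ≤ (l * (k : ℝ≥0∞) ^ m)⁻¹ * (4 *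
      ∑ j ∈ Finset.range (m + 1), ∑ y ∈ Dn x (m - j) j, Hf g l (m - j) j y) := by gcongr
    _ = 4 * ∑ j ∈ Finset.range (m + 1), (l * (k : ℝ≥0∞) ^ m)⁻¹ *
        ∑ y ∈ Dn x (m - j) j, Hf g l (m - j) j y := by rw [← Finset.mul_sum]; ring
    _ ≤ 4 * ∑ j ∈ Finset.range (m + 1), ∑' i : ℕ, (l * (k : ℝ≥0∞) ^ (i + j))⁻¹ *
        ∑ y ∈ Dn x i j, Hf g l i j y := by
        gcongr with j hj
        have hjm : m - j + j = m := by simp at hj; omega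
        have := ENNReal.le_tsum (f := fun i => (l * (k : ℝ≥0∞) ^ (i + j))⁻¹ *
          ∑ y ∈ Dn x i j, Hf g l i j y) (m - j)
        simpa only [hjm] using this
    _ ≤ _ := by gcongr; exact ENNReal.sum_le_tsum _

lemma const_fin (k : ℕ) (hk : 2 ≤ k) (s : ℝ) (hs : 1 < s) :
    ∑' j : ℕ, ((k : ℝ≥0∞) ^ (-((s - 1) / s))) ^ j * (((2 * j + 3 : ℕ) : ℝ≥0∞) + 2) ≠ ⊤ := by
  have hk0 : (k : ℝ≥0) ≠ 0 := by simp; omega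
  set q : ℝ≥0 := (k : ℝ≥0) ^ (-((s - 1) / s)) with hq
  have hq1 : q < 1 := by
    apply NNReal.rpow_lt_one_of_one_lt_of_neg
    · exact_mod_cast (by omega : 1 < k)
    · have : 0 < (s - 1) / s := div_pos (by linarith) (by linarith)
      linarith
  have e : (k : ℝ≥0∞) ^ (-((s - 1) / s)) = (q : ℝ≥0∞) := by
    rw [hq, ENNReal.coe_rpow_of_ne_zero hk0]; simp
  rw [e]
  have : (fun j : ℕ => (q : ℝ≥0∞) ^ j * (((2 * j + 3 : ℕ) : ℝ≥0∞) + 2)) =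
      fun j : ℕ => ((q ^ j * (((2 * j + 3 : ℕ) : ℝ≥0) + 2) : ℝ≥0) : ℝ≥0∞) := by
    funext j; push_cast; rfl
  rw [this, ENNReal.tsum_coe_ne_top_iff_summable, ← NNReal.summable_coe]
  have hn : ‖(q : ℝ)‖ < 1 := by simpa using hq1
  have s1 := summable_pow_mul_geometric_of_norm_lt_one 1 hn
  have s0 := summable_pow_mul_geometric_of_norm_lt_one 0 hn
  refine ((s1.mul_left 2).add (s0.mul_left 5)).congr fun j => ?_
  push_cast
  ring

lemma weak_main {k : ℕ} (hk : 2 ≤ k) (w : V k → ℝ≥0∞) (s : ℝ) (hs : 1 < s)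
    (C : ℝ≥0) (hC : ∀ x : V k, MsBall s w x ≤ (C : ℝ≥0∞) * w x)
    (g : V k → ℝ≥0∞) (hg : ∀ y, g y ≠ ⊤) (l : ℝ≥0∞) (hl : l ≠ 0) (hlt : l ≠ ⊤) :
    wsum w {x | l < Mball g x} ≤ (16 * C * 
      ∑' j : ℕ, ((k : ℝ≥0∞) ^ (-((s - 1) / s))) ^ j * (((2 * j + 3 : ℕ) : ℝ≥0∞) + 2)) *
      l⁻¹ * ∑' y, g y * w y := by
  classical
  have hk0 : (k : ℝ≥0∞) ≠ 0 := by simp; omega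
  have hkt : (k : ℝ≥0∞) ≠ ⊤ := by simp
  set q : ℝ≥0∞ := (k : ℝ≥0∞) ^ (-((s - 1) / s)) with hq
  have step (i j : ℕ) (y : V k) : ∑' x : V k, (if y ∈ Dn x i j then w x else 0) ≤
      4 * C * (k : ℝ≥0∞) ^ (i + j) * q ^ j * w y := by
    refine le_trans (le_of_eq ?_) (w_Dn hk w s hs C hC y j i)
    rw [tsum_eq_sum (s := Dn y j i)]
    · refine Finset.sum_congr rfl fun x hx => ?_
      rw [if_pos ((Dn_symm _ _ _ _).1 hx)]
    · intro x hx
      rw [if_neg (fun h => hx ((Dn_symm _ _ _ _).2 h))]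
  calc wsum w {x | l < Mball g x}
      = ∑' x, Set.indicator {x | l < Mball g x} w x := tsum_subtype _ _
    _ ≤ ∑' x, w x * (4 * ∑' j : ℕ, ∑' i : ℕ, (l * (k : ℝ≥0∞) ^ (i + j))⁻¹ *
          ∑ y ∈ Dn x i j, Hf g l i j y) := by
        refine ENNReal.tsum_le_tsum fun x => ?_
        by_cases hx : l < Mball g x
        · rw [Set.indicator_of_mem (by exact hx)]
          exact le_mul_of_one_le_right zero_le (pointwise_b hk g l hl hlt x hx)
        · rw [Set.indicator_of_notMem (by exact hx)]; exact zero_le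
    _ = ∑' x, ∑' j : ℕ, ∑' i : ℕ, ∑' y, 4 * (l * (k : ℝ≥0∞) ^ (i + j))⁻¹ * Hf g l i j y *
          (if y ∈ Dn x i j then w x else 0) := by
        refine tsum_congr fun x => ?_
        rw [← ENNReal.tsum_mul_left, ← ENNReal.tsum_mul_left]
        refine tsum_congr fun j => ?_
        rw [← ENNReal.tsum_mul_left, ← ENNReal.tsum_mul_left]
        refine tsum_congr fun i => ?_
        rw [tsum_eq_sum (s := Dn x i j)]
        · rw [Finset.mul_sum, Finset.mul_sum, Finset.mul_sum]
          refine Finset.sum_congr rfl fun y hy => ?_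
          rw [if_pos hy]; ring
        · intro y hy
          rw [if_neg hy, mul_zero]
    _ = ∑' y, ∑' j : ℕ, ∑' i : ℕ, 4 * (l * (k : ℝ≥0∞) ^ (i + j))⁻¹ * Hf g l i j y *
          ∑' x, (if y ∈ Dn x i j then w x else 0) := by
        simp_rw [← ENNReal.tsum_mul_left]
        rw [ENNReal.tsum_comm]
        simp_rw [ENNReal.tsum_comm (α := V k) (β := ℕ)]
        refine tsum_congr fun j => tsum_congr fun i => ?_
        rw [ENNReal.tsum_comm]
    _ ≤ ∑' y, ∑' j : ℕ, ∑' i : ℕ, 16 * C * l⁻¹ * q ^ j * w y * Hf g l i j y := by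
        refine ENNReal.tsum_le_tsum fun y => ENNReal.tsum_le_tsum fun j =>
          ENNReal.tsum_le_tsum fun i => ?_
        refine (mul_le_mul_right (step i j y) _).trans (le_of_eq ?_)
        rw [ENNReal.mul_inv (Or.inl hl) (Or.inl hlt)]
        calc _ = 16 * C * l⁻¹ * q ^ j * w y * Hf g l i j y *
              (((k : ℝ≥0∞) ^ (i + j))⁻¹ * (k : ℝ≥0∞) ^ (i + j)) := by ring
          _ = _ := by
            rw [ENNReal.inv_mul_cancel (pow_ne_zero _ hk0) (ENNReal.pow_ne_top hkt), mul_one]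
    _ ≤ ∑' y, ∑' j : ℕ, 16 * C * l⁻¹ * q ^ j * w y * ((((2 * j + 3 : ℕ) : ℝ≥0∞) + 2) * g y) := by
        refine ENNReal.tsum_le_tsum fun y => ENNReal.tsum_le_tsum fun j => ?_
        rw [ENNReal.tsum_mul_left]
        gcongr
        refine le_trans ?_ (scalar_sum k hk (g y) l (hg y) hl hlt (2 * j + 3))
        exact ENNReal.tsum_comp_le_tsum_of_injective (add_left_injective j)
          (fun r => if l * (k : ℝ≥0∞) ^ r < g y * (k : ℝ≥0∞) ^ (2 * j + 3)
            then min (g y) (l * (k : ℝ≥0∞) ^ r) else 0)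
    _ = _ := by
        rw [← ENNReal.tsum_mul_left]
        refine tsum_congr fun y => ?_
        rw [← ENNReal.tsum_mul_left, ← ENNReal.tsum_mul_right, ← ENNReal.tsum_mul_right]
        refine tsum_congr fun j => ?_
        ring

/-- If `M_s w ≤ C w` pointwise for some `s > 1`, then the weighted weak type
(1,1) estimate `w({Mf > λ}) ≲ (1/λ) Σ_x |f(x)| w(x)` holds. -/
theorem stmt8 (k : ℕ) (hk : 2 ≤ k) (w : V k → ℝ≥0∞) (s : ℝ) (hs : 1 < s)
    (C : ℝ≥0) (hC : ∀ x : V k, MsBall s w x ≤ (C : ℝ≥0∞) * w x) :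
    ∃ c : ℝ≥0, ∀ (f : V k → ℝ),
      (∑' x : V k, ENNReal.ofReal |f x| * w x) ≠ ⊤ → ∀ lam : ℝ, 0 < lam →
      wsum w {x : V k | ENNReal.ofReal lam < Mball (absE f) x} ≤
        (c : ℝ≥0∞) * (ENNReal.ofReal lam)⁻¹ *
          ∑' x : V k, ENNReal.ofReal |f x| * w x := by
  have hfin := const_fin k hk s hs
  set K := ∑' j : ℕ, ((k : ℝ≥0∞) ^ (-((s - 1) / s))) ^ j * (((2 * j + 3 : ℕ) : ℝ≥0∞) + 2) with hK
  have hKt : 16 * (C : ℝ≥0∞) * K ≠ ⊤ :=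
    ENNReal.mul_ne_top (ENNReal.mul_ne_top (by norm_num) ENNReal.coe_ne_top) hfin
  refine ⟨(16 * (C : ℝ≥0∞) * K).toNNReal, fun f _ lam hlam => ?_⟩
  rw [ENNReal.coe_toNNReal hKt]
  exact weak_main hk w s hs C hC (absE f) (fun y => ENNReal.ofReal_ne_top) (ENNReal.ofReal lam)
    (by simpa using hlam) ENNReal.ofReal_ne_top
end
end
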